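/- Let D be a weighted oriented graph consisting of two unbalanced cycles C_m and C_n connected by a path P of length k, labelled so that E(C_m) = {e_1,…,e_m}, E(P) = {e_{m+1},…,e_{m+k}}, E(C_n) = {e_{m+k+1},…,e_{m+k+n}}, with e_i incident with v_i and v_{i+1} for 1 ≤ i ≤ m−1, e_m with v_m and v_1, e_{m+i} incident with v_{m+i−1} and v_{m+i} for 1 ≤ i ≤ k+n−1 (where v_m+0 := v_1), and e_{m+k+n} with v_{m+k+n−1} and v_{m+k}. Then I_D is generated by the primitive binomial f_c, where c = (1/d)·( ((−1)^{i+1} p·r_i)_{i=1}^{m}, ((−1)^{i} p·q·r_{m+i})_{i=1}^{k}, ((−1)^{i+k} q·r_{m+k+i})_{i=1}^{n} ) ∈ ℤ^{m+k+n}, with r_i = M_k(A(P)[k+1|∅])·M_{m−1}(A(C_m)[1|i]) for 1 ≤ i ≤ m, r_{m+i} = M_{k−1}(A(P)[1,k+1|i]) for 1 ≤ i ≤ k, r_{m+k+i} = M_k(A(P)[1|∅])·M_{n−1}(A(C_n)[1|i]) for 1 ≤ i ≤ n, q = det(A(C_m)), p = det(A(C_n)), and d = gcd( (|p|·r_i)_{i=1}^{m},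 (|p·q|·r_{m+i})_{i=1}^{k}, (|q|·r_{m+k+i})_{i=1}^{n} ). -/

import Mathlib

open MvPolynomial Finset

noncomputable def binomPlus (K : Type*) [Field K] {ι : Type*} [Fintype ι]
    (b : ι → ℤ) : MvPolynomial ι K :=
  ∏ e, X e ^ (b e).toNat

noncomputable def binomMinus (K : Type*) [Field K] {ι : Type*} [Fintype ι]
    (b : ι → ℤ) : MvPolynomial ι K :=
  ∏ e, X e ^ (-b e).toNat

noncomputable def binom (K : Type*) [Field K] {ι : Type*} [Fintype ι]
    (b : ι → ℤ) : MvPolynomial ι K :=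
  binomPlus K b - binomMinus K b

/-- `f_b` is a primitive binomial of the ideal `I`. -/
def IsPrimitiveIn (K : Type*) [Field K] {ι : Type*} [Fintype ι]
    (I : Ideal (MvPolynomial ι K)) (b : ι → ℤ) : Prop :=
  b ≠ 0 ∧ binom K b ∈ I ∧
    ∀ c : ι → ℤ, c ≠ 0 → binom K c ∈ I →
      binomPlus K c ∣ binomPlus K b → binomMinus K c ∣ binomMinus K b → c = b

/-- The toric ideal of an `n × m` matrix of non-negative integers: the kernel of
`K[e_1,…,e_m] → K[x_1,…,x_n]`, `e_j ↦ ∏ i, x_i ^ (A i j)`. -/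
noncomputable def matToricIdeal (K : Type*) [Field K] {n m : ℕ}
    (A : Matrix (Fin n) (Fin m) ℕ) : Ideal (MvPolynomial (Fin m) K) :=
  RingHom.ker (aeval (R := K)
    (fun j => ∏ i, X i ^ A i j) :
      MvPolynomial (Fin m) K →ₐ[K] MvPolynomial (Fin n) K).toRingHom

/-! ### Toric ideals with a kernel lattice of rank one -/

section RankOne

variable {K : Type*} [Field K] {ι κ : Type*} [Fintype ι]

lemma binomPlus_eq_monomial (b : ι → ℤ) :
    binomPlus K b = monomial (Finsupp.equivFunOnFinite.symm fun e => (b e).toNat) 1 := by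
  rw [monomial_eq, Finsupp.prod_fintype _ _ (by simp)]
  simp [binomPlus]

lemma binomMinus_eq_monomial (b : ι → ℤ) :
    binomMinus K b = monomial (Finsupp.equivFunOnFinite.symm fun e => (-b e).toNat) 1 := by
  rw [monomial_eq, Finsupp.prod_fintype _ _ (by simp)]
  simp [binomMinus]

lemma aeval_monomial_monomial (E : ι → κ →₀ ℕ) (u : ι →₀ ℕ) (r : K) :
    aeval (R := K) (fun e => (monomial (E e) 1 : MvPolynomial κ K)) (monomial u r) =
      monomial (∑ e, u e • E e) r := by
  rw [aeval_monomial, Finsupp.prod_fintype _ _ (by simp)]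
  simp only [monomial_pow, one_pow]
  have : ∏ e, (monomial (u e • E e) 1 : MvPolynomial κ K) = monomial (∑ e, u e • E e) 1 := by
    rw [monomial_sum_one]
  rw [this, algebraMap_eq, C_mul_monomial, mul_one]

lemma monomial_sub_mem_span_binom (c : ι → ℤ) (k : ℕ) (u v : ι →₀ ℕ)
    (h : ∀ e, (u e : ℤ) - v e = k * c e) :
    (monomial u 1 - monomial v 1 : MvPolynomial ι K) ∈ Ideal.span {binom K c} := by
  have hu : u = u ⊓ v + k • Finsupp.equivFunOnFinite.symm fun e => (c e).toNat := by
    ext e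
    have := h e
    rcases le_total 0 (c e) with hc | hc
    · have h1 : (0 : ℤ) ≤ k * c e := by positivity
      simp only [Finsupp.add_apply, Finsupp.inf_apply, Finsupp.smul_apply, smul_eq_mul,
        Finsupp.equivFunOnFinite_symm_apply_apply]
      zify
      rw [Int.toNat_of_nonneg hc, ← this, min_eq_right (by linarith)]
      ring
    · have h1 : (k : ℤ) * c e ≤ 0 := mul_nonpos_of_nonneg_of_nonpos (by positivity) hc
      simp only [Finsupp.add_apply, Finsupp.inf_apply, Finsupp.smul_apply, smul_eq_mul,
        Finsupp.equivFunOnFinite_symm_apply_apply, Int.toNat_of_nonpos hc]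
      rw [min_eq_left (by linarith)]
      simp
  have hv : v = u ⊓ v + k • Finsupp.equivFunOnFinite.symm fun e => (-c e).toNat := by
    ext e
    have := h e
    rcases le_total 0 (c e) with hc | hc
    · have h1 : (0 : ℤ) ≤ k * c e := by positivity
      simp only [Finsupp.add_apply, Finsupp.inf_apply, Finsupp.smul_apply, smul_eq_mul,
        Finsupp.equivFunOnFinite_symm_apply_apply, Int.toNat_of_nonpos (neg_nonpos.2 hc)]
      rw [min_eq_right (by linarith)]
      simp
    · have h1 : (k : ℤ) * c e ≤ 0 := mul_nonpos_of_nonneg_of_nonpos (by positivity) hc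
      simp only [Finsupp.add_apply, Finsupp.inf_apply, Finsupp.smul_apply, smul_eq_mul,
        Finsupp.equivFunOnFinite_symm_apply_apply]
      zify
      rw [Int.toNat_of_nonneg (neg_nonneg.2 hc), mul_neg, ← this, min_eq_left (by linarith)]
      ring
  have key : (monomial u 1 - monomial v 1 : MvPolynomial ι K) =
      monomial (u ⊓ v) 1 * (binomPlus K c ^ k - binomMinus K c ^ k) := by
    rw [binomPlus_eq_monomial, binomMinus_eq_monomial, monomial_pow, monomial_pow, mul_sub,
      monomial_mul, monomial_mul, ← hu, ← hv]
    simp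
  rw [key, Ideal.mem_span_singleton]
  exact Dvd.dvd.mul_left (sub_dvd_pow_sub_pow _ _ k) _

lemma binom_mem_ker_iff (E : ι → κ →₀ ℕ) (b : ι → ℤ) :
    binom K b ∈ RingHom.ker (aeval (R := K)
      (fun e => (monomial (E e) 1 : MvPolynomial κ K))).toRingHom ↔
      ∀ v, ∑ e, (E e v : ℤ) * b e = 0 := by
  rw [RingHom.mem_ker, binom, binomPlus_eq_monomial, binomMinus_eq_monomial]
  simp only [AlgHom.toRingHom_eq_coe, RingHom.coe_coe, map_sub, aeval_monomial_monomial]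
  rw [sub_eq_zero, monomial_left_inj one_ne_zero, DFunLike.ext_iff]
  refine forall_congr' fun v => ?_
  simp only [Finsupp.coe_finsetSum, Finset.sum_apply, Finsupp.smul_apply, smul_eq_mul,
    Finsupp.equivFunOnFinite_symm_apply_apply]
  zify
  rw [← sub_eq_zero, ← Finset.sum_sub_distrib]
  refine Eq.congr_left (Finset.sum_congr rfl fun e _ => ?_)
  rw [← sub_mul, mul_comm]
  congr 1
  rcases le_total 0 (b e) with h | h
  · simp [h]
  · simp [h]

lemma ker_aeval_monomial_le (E : ι → κ →₀ ℕ) (J : Ideal (MvPolynomial ι K))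
    (hJ : ∀ u v : ι →₀ ℕ, ∑ e, u e • E e = ∑ e, v e • E e →
      (monomial u 1 - monomial v 1 : MvPolynomial ι K) ∈ J) :
    RingHom.ker (aeval (R := K)
      (fun e => (monomial (E e) 1 : MvPolynomial κ K))).toRingHom ≤ J := by
  intro f hf
  set φ := aeval (R := K) (fun e => (monomial (E e) 1 : MvPolynomial κ K)) with hφ
  let F : (ι →₀ ℕ) → κ →₀ ℕ := fun u => ∑ e, u e • E e
  let ψ : MvPolynomial κ K →ₗ[K] MvPolynomial ι K :=
    (basisMonomials κ K).constr K fun s => monomial (Function.invFun F s) 1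
  have hψ : ∀ s, ψ (monomial s 1) = monomial (Function.invFun F s) 1 := fun s => by
    simpa using (basisMonomials κ K).constr_basis K
      (fun s => (monomial (Function.invFun F s) 1 : MvPolynomial ι K)) s
  have key : ∀ g : MvPolynomial ι K, g - ψ (φ g) ∈ J := by
    intro g
    induction g using MvPolynomial.induction_on' with
    | monomial u r =>
      have h1 : φ (monomial u r) = r • monomial (F u) 1 := by
        rw [hφ, aeval_monomial_monomial, smul_monomial, smul_eq_mul, mul_one]
      have h2 : (monomial u r : MvPolynomial ι K) = r • monomial u 1 := by
        rw [smul_monomial, smul_eq_mul, mul_one]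
      rw [h1, map_smul, hψ, h2, ← smul_sub]
      exact Submodule.smul_of_tower_mem J r
        (hJ _ _ (Function.invFun_eq (f := F) ⟨u, rfl⟩).symm)
    | add g h hg hh =>
      rw [map_add, map_add, add_sub_add_comm]
      exact J.add_mem hg hh
  have hf0 : φ f = 0 := hf
  simpa [hf0] using key f

lemma toNat_le_of_monomial_dvd {s t : ι → ℕ}
    (h : (monomial (Finsupp.equivFunOnFinite.symm s) 1 : MvPolynomial ι K) ∣
      monomial (Finsupp.equivFunOnFinite.symm t) 1) (e : ι) : s e ≤ t e := by
  rw [monomial_dvd_monomial] at h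
  simpa using (h.1.resolve_left one_ne_zero) e

/-- If the kernel lattice of the exponent vectors `E` is generated by `c ≠ 0`, then the toric
ideal is generated by the primitive binomial `f_c`. -/
theorem toric_of_kernel_rank_one (E : ι → κ →₀ ℕ) (c : ι → ℤ) (hc0 : c ≠ 0)
    (hker : ∀ v, ∑ e, (E e v : ℤ) * c e = 0)
    (hgen : ∀ u : ι → ℤ, (∀ v, ∑ e, (E e v : ℤ) * u e = 0) → ∃ k : ℤ, ∀ e, u e = k * c e)
    (I : Ideal (MvPolynomial ι K))
    (hI : I = RingHom.ker (aeval (R := K)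
      (fun e => (monomial (E e) 1 : MvPolynomial κ K))).toRingHom) :
    IsPrimitiveIn K I c ∧ I = Ideal.span {binom K c} := by
  have hmem : binom K c ∈ I := by rwa [hI, binom_mem_ker_iff]
  refine ⟨⟨hc0, hmem, fun c' hc' hm hp hn => ?_⟩, le_antisymm ?_ ?_⟩
  · rw [hI, binom_mem_ker_iff] at hm
    obtain ⟨k, hk⟩ := hgen c' hm
    rw [binomPlus_eq_monomial, binomPlus_eq_monomial] at hp
    rw [binomMinus_eq_monomial, binomMinus_eq_monomial] at hn
    have hp' := toNat_le_of_monomial_dvd hp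
    have hn' := toNat_le_of_monomial_dvd hn
    obtain ⟨e, he⟩ := Function.ne_iff.1 hc0
    have hpe := hp' e
    have hne := hn' e
    have hke := hk e
    have he' : c e ≠ 0 := he
    have hk0 : k ≠ 0 := by
      rintro rfl
      exact hc' (funext fun e => by simp [hk e])
    have hk1 : k = 1 := by
      rcases lt_or_gt_of_ne hk0 with h | h <;> rcases lt_or_gt_of_ne he' with h' | h'
      · have : 0 < c' e := by rw [hke]; exact mul_pos_of_neg_of_neg h h'
        omega
      · have : c' e < 0 := by rw [hke]; exact mul_neg_of_neg_of_pos h h'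
        omega
      · have : c e ≤ c' e := by omega
        nlinarith
      · have : c' e ≤ c e := by omega
        nlinarith
    exact funext fun e => by simp [hk e, hk1]
  · rw [hI]
    refine ker_aeval_monomial_le E _ fun u v huv => ?_
    obtain ⟨k, hk⟩ := hgen (fun e => (u e : ℤ) - v e) fun x => by
      have := DFunLike.congr_fun huv x
      simp only [Finsupp.coe_finsetSum, Finset.sum_apply, Finsupp.smul_apply,
        smul_eq_mul] at this
      zify at this
      simp only [mul_sub, Finset.sum_sub_distrib, sub_eq_zero]
      simpa only [mul_comm] using this
    obtain ⟨n, rfl | rfl⟩ := k.eq_nat_or_neg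
    · exact monomial_sub_mem_span_binom c n u v hk
    · rw [← neg_sub]
      refine neg_mem (monomial_sub_mem_span_binom c n v u fun e => ?_)
      linarith [hk e]
  · rwa [Ideal.span_le, Set.singleton_subset_iff]

end RankOne

/-! ### The linear system of two cycles joined by a path -/

section Dumbbell

open Matrix

lemma sum_mul_alternating_minor {n : ℕ} (N : Matrix (Fin n) (Fin (n + 1)) ℤ)
    (r : Fin (n + 1) → ℤ) :
    ∑ j, r j * ((-1) ^ (j : ℕ) * (N.submatrix id j.succAbove).det) =
      (Matrix.of (Fin.cons r N) : Matrix (Fin (n + 1)) (Fin (n + 1)) ℤ).det := by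
  rw [det_succ_row_zero]
  refine Finset.sum_congr rfl fun j _ => ?_
  have : (Matrix.of (Fin.cons r N) : Matrix (Fin (n + 1)) (Fin (n + 1)) ℤ).submatrix
      Fin.succ j.succAbove = N.submatrix id j.succAbove := by
    rfl
  have h0 : (Matrix.of (Fin.cons r N) : Matrix (Fin (n + 1)) (Fin (n + 1)) ℤ) 0 j = r j := rfl
  rw [this, h0]
  ring

lemma sum_row_mul_alternating_minor {n : ℕ} (N : Matrix (Fin n) (Fin (n + 1)) ℤ) (i : Fin n) :
    ∑ j, N i j * ((-1) ^ (j : ℕ) * (N.submatrix id j.succAbove).det) = 0 := by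
  rw [sum_mul_alternating_minor]
  exact det_zero_of_row_eq (Fin.succ_ne_zero i).symm rfl

lemma mulVec_alternating_minor {n : ℕ} (M : Matrix (Fin (n + 1)) (Fin (n + 1)) ℤ) (s : ℤ)
    (i : Fin (n + 1)) :
    (M *ᵥ fun j => s * ((-1) ^ (j : ℕ) * (M.submatrix Fin.succ j.succAbove).det)) i =
      if i = 0 then s * M.det else 0 := by
  have h := fun r => sum_mul_alternating_minor (M.submatrix Fin.succ id) r
  have h' := fun r => sum_row_mul_alternating_minor (M.submatrix Fin.succ id) r
  simp only [submatrix_submatrix, Function.comp_id, Function.id_comp] at h h'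
  simp only [mulVec, dotProduct, mul_left_comm _ s, ← Finset.mul_sum]
  refine Fin.cases ?_ (fun i => ?_) i
  · rw [if_pos rfl, h]
    congr 2
    ext i k
    refine Fin.cases ?_ (fun i => ?_) i <;> rfl
  · rw [if_neg (Fin.succ_ne_zero i)]
    rw [show ∑ j, M i.succ j * ((-1) ^ (j : ℕ) *
      (M.submatrix Fin.succ j.succAbove).det) = 0 from h' i, mul_zero]

/-- The vertex equations of two cycles, with incidence matrices `Am` and `An`, joined at their
first vertices by a path with incidence matrix `AP`. -/
def DumbbellSystem {a b k : ℕ} (Am : Matrix (Fin (a + 1)) (Fin (a + 1)) ℤ)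
    (AP : Matrix (Fin (k + 2)) (Fin (k + 1)) ℤ) (An : Matrix (Fin (b + 1)) (Fin (b + 1)) ℤ)
    (x : Fin (a + 1) → ℤ) (y : Fin (k + 1) → ℤ) (z : Fin (b + 1) → ℤ) : Prop :=
  (∀ i, (Am *ᵥ x) i + (if i = 0 then (AP *ᵥ y) 0 else 0) = 0) ∧
  (∀ j : Fin k, (AP *ᵥ y) j.succ.castSucc = 0) ∧
  (∀ i, (An *ᵥ z) i + (if i = 0 then (AP *ᵥ y) (Fin.last _) else 0) = 0)

variable {a b k : ℕ} {Am : Matrix (Fin (a + 1)) (Fin (a + 1)) ℤ}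
    {AP : Matrix (Fin (k + 2)) (Fin (k + 1)) ℤ} {An : Matrix (Fin (b + 1)) (Fin (b + 1)) ℤ}

lemma dumbbellSystem_minors :
    DumbbellSystem Am AP An
      (fun i => An.det * (AP.submatrix Fin.castSucc id).det *
        ((-1) ^ (i : ℕ) * (Am.submatrix Fin.succ i.succAbove).det))
      (fun i => -(An.det * Am.det) * ((-1) ^ (i : ℕ) *
        (AP.submatrix (fun t : Fin k => t.succ.castSucc) i.succAbove).det))
      (fun i => (-1) ^ k * Am.det * (AP.submatrix Fin.succ id).det *
        ((-1) ^ (i : ℕ) * (An.submatrix Fin.succ i.succAbove).det)) := by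
  have h0 := mulVec_alternating_minor (AP.submatrix Fin.castSucc id) (-(An.det * Am.det))
  have hl : (AP.submatrix Fin.succ id).det = _ :=
    det_succ_row (AP.submatrix Fin.succ id) (Fin.last k)
  simp only [submatrix_submatrix, Function.id_comp] at h0 hl
  refine ⟨fun i => ?_, fun j => ?_, fun i => ?_⟩
  · rw [mulVec_alternating_minor]
    split_ifs
    · have := h0 0
      rw [if_pos rfl] at this
      exact (congrArg (_ + ·) this).trans (by ring)
    · simp
  · have := h0 j.succ
    rw [if_neg (Fin.succ_ne_zero j)] at this
    exact this
  · rw [mulVec_alternating_minor]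
    split_ifs
    · have e1 : (Fin.succ ∘ (Fin.last k).succAbove : Fin k → Fin (k + 2)) =
          fun t => t.succ.castSucc := by
        ext t; simp
      rw [e1] at hl
      nth_rewrite 1 [hl]
      simp only [mulVec, dotProduct, Finset.mul_sum, Finset.sum_mul, ← Finset.sum_add_distrib]
      refine Finset.sum_eq_zero fun j _ => ?_
      have : ((-1 : ℤ) ^ k) * (-1) ^ k = 1 := by rw [← mul_pow]; simp
      simp only [submatrix_apply, Fin.succ_last, id, Fin.val_last, pow_add]
      linear_combination (Am.det * An.det * (-1) ^ (j : ℕ) * AP (Fin.last (k + 1)) j *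
        (AP.submatrix (fun t : Fin k => t.succ.castSucc) j.succAbove).det) * this
    · simp

lemma det_path_ne_zero (hlow : ∀ i j : Fin (k + 1), i < j → AP i.castSucc j = 0)
    (hdiag : ∀ i : Fin (k + 1), AP i.castSucc i ≠ 0) :
    (AP.submatrix Fin.castSucc id).det ≠ 0 := by
  rw [det_of_isLowerTriangular (M := AP.submatrix Fin.castSucc id) fun i j h => hlow i j h]
  exact Finset.prod_ne_zero_iff.2 fun i _ => hdiag i

lemma DumbbellSystem.eq_zero {x : Fin (a + 1) → ℤ} {y : Fin (k + 1) → ℤ} {z : Fin (b + 1) → ℤ}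
    (h : DumbbellSystem Am AP An x y z) (hm : Am.det ≠ 0) (hn : An.det ≠ 0)
    (hlow : ∀ i j : Fin (k + 1), i < j → AP i.castSucc j = 0)
    (hdiag : ∀ i : Fin (k + 1), AP i.castSucc i ≠ 0) (hy : y 0 = 0) :
    x = 0 ∧ y = 0 ∧ z = 0 := by
  obtain ⟨h1, h2, h3⟩ := h
  have y0 : y = 0 := by
    refine eq_zero_of_mulVec_eq_zero (det_path_ne_zero hlow hdiag) (funext fun i => ?_)
    refine Fin.cases ?_ (fun i => h2 i) i
    rw [mulVec, dotProduct]
    refine Finset.sum_eq_zero fun j _ => ?_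
    refine Fin.cases ?_ (fun j => ?_) j
    · rw [hy, mul_zero]
    · rw [submatrix_apply, id, hlow 0 j.succ (Fin.succ_pos j), zero_mul]
  subst y0
  simp only [mulVec_zero, Pi.zero_apply, ite_self, add_zero] at h1 h3
  exact ⟨eq_zero_of_mulVec_eq_zero hm (funext h1), rfl, eq_zero_of_mulVec_eq_zero hn (funext h3)⟩

lemma sum_fin_dumbbell {M : Type*} [AddCommMonoid M] (k a b : ℕ)
    (f : Fin (a + b + k + 3) → M) :
    ∑ e, f e = ∑ i : Fin (a + 1), f ⟨i, by omega⟩ +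
      ∑ i : Fin (k + 1), f ⟨a + 1 + i, by omega⟩ +
      ∑ i : Fin (b + 1), f ⟨a + k + 2 + i, by omega⟩ := by
  have hN : (a + 1) + (k + 1) + (b + 1) = a + b + k + 3 := by omega
  rw [← Fintype.sum_equiv (finCongr hN) (fun e => f (finCongr hN e)) f fun _ => rfl,
    Fin.sum_univ_add, Fin.sum_univ_add]
  congr 1
  refine Finset.sum_congr rfl fun i _ => congrArg f (Fin.ext ?_)
  simp
  omega

end Dumbbell

lemma dvd_mul_finset_gcd {α : Type*} (s : Finset α) (f : α → ℕ) (x y : ℕ)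
    (h : ∀ i ∈ s, x ∣ y * f i) : x ∣ y * s.gcd f := by
  have := Finset.dvd_gcd h
  rwa [Finset.gcd_mul_left, normalize_eq] at this

section DumbbellGraph

open Matrix

variable {k a b : ℕ} {A : Matrix (Fin (a + b + k + 2)) (Fin (a + b + k + 3)) ℤ}
  {endA endB : Fin (a + b + k + 3) → Fin (a + b + k + 2)}
  {Am : Matrix (Fin (a + 1)) (Fin (a + 1)) ℤ}
  {AP : Matrix (Fin (k + 2)) (Fin (k + 1)) ℤ} {An : Matrix (Fin (b + 1)) (Fin (b + 1)) ℤ}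

lemma forall_sum_eq_zero_iff_dumbbellSystem
    (hendA : ∀ j, (endA j : ℕ) =
      if (j : ℕ) < a + 1 then (j : ℕ)
      else if (j : ℕ) = a + 1 then 0 else (j : ℕ) - 1)
    (hendB : ∀ j, (endB j : ℕ) =
      if (j : ℕ) < a + 1 then ((j : ℕ) + 1) % (a + 1)
      else if (j : ℕ) = a + b + k + 2 then a + k + 1 else (j : ℕ))
    (hA0 : ∀ v e, endA e ≠ v → endB e ≠ v → A v e = 0)
    (hAm : ∀ i j, Am i j =
      A (Fin.castLE (by omega) i) (Fin.castLE (by omega) j))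
    (hAP : ∀ i j, AP i j =
      A (if (i : ℕ) = 0 then ⟨0, by omega⟩ else ⟨a + (i : ℕ), by omega⟩)
        ⟨a + 1 + (j : ℕ), by omega⟩)
    (hAn : ∀ i j, An i j =
      A ⟨a + k + 1 + (i : ℕ), by omega⟩ ⟨a + k + 2 + (j : ℕ), by omega⟩)
    (hb : 0 < b) (u : Fin (a + b + k + 3) → ℤ) :
    (∀ v, ∑ e, A v e * u e = 0) ↔
      DumbbellSystem Am AP An (fun i => u ⟨i, by omega⟩) (fun i => u ⟨a + 1 + i, by omega⟩)
        (fun i => u ⟨a + k + 2 + i, by omega⟩) := by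
  have A1 : ∀ (v : Fin (a + b + k + 2)) (i : Fin (a + 1)), a < v →
      A v ⟨i, by omega⟩ = 0 := by
    intro v i hv
    have := Nat.mod_lt ((i : ℕ) + 1) (Nat.succ_pos a)
    apply hA0 <;> rw [Ne, Fin.ext_iff]
    · rw [hendA]; simp only; split_ifs <;> omega
    · rw [hendB]; simp only; rw [if_pos i.2]; simp only [Nat.succ_eq_add_one] at this; omega
  have A2 : ∀ (v : Fin (a + b + k + 2)) (i : Fin (k + 1)), (v : ℕ) ≠ 0 → (v ≤ a ∨ a + k + 1 < v) →
      A v ⟨a + 1 + i, by omega⟩ = 0 := by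
    intro v i hv hv'
    have := i.2
    apply hA0 <;> rw [Ne, Fin.ext_iff]
    · rw [hendA]; simp only; split_ifs <;> omega
    · rw [hendB]; simp only; split_ifs <;> omega
  have A3 : ∀ (v : Fin (a + b + k + 2)) (i : Fin (b + 1)), (v : ℕ) < a + k + 1 →
      A v ⟨a + k + 2 + i, by omega⟩ = 0 := by
    intro v i hv
    have := i.2
    apply hA0 <;> rw [Ne, Fin.ext_iff]
    · rw [hendA]; simp only; split_ifs <;> omega
    · rw [hendB]; simp only; split_ifs <;> omega
  have B2 : ∀ (v : Fin (a + b + k + 2)) (i : Fin (k + 2)) (j : Fin (k + 1)),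
      (v : ℕ) = (if (i : ℕ) = 0 then 0 else a + i) → A v ⟨a + 1 + j, by omega⟩ = AP i j := by
    intro v i j h
    rw [hAP]
    congr 1
    apply Fin.ext
    rw [h]
    split_ifs <;> rfl
  have R1 : ∀ i : Fin (a + 1), ∑ e, A ⟨i, by omega⟩ e * u e =
      (Am *ᵥ fun i => u ⟨i, by omega⟩) i +
        (if i = 0 then (AP *ᵥ fun i => u ⟨a + 1 + i, by omega⟩) 0 else 0) := by
    intro i
    rw [sum_fin_dumbbell, Finset.sum_eq_zero (s := Finset.univ (α := Fin (b + 1))), add_zero]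
    · congr 1
      · exact Finset.sum_congr rfl fun j _ => (congrArg (· * _) (hAm i j)).symm
      · split_ifs with h
        · subst h
          exact Finset.sum_congr rfl fun j _ => by rw [B2 _ 0 j]; simp
        · refine Finset.sum_eq_zero fun j _ => ?_
          rw [A2 _ _ (fun h' => h (Fin.ext h')) (Or.inl (Nat.lt_succ_iff.1 i.2)), zero_mul]
    · intro j _
      rw [A3 _ _ (by simp only; omega), zero_mul]
  have R2 : ∀ i : Fin k, ∑ e, A ⟨a + 1 + i, by omega⟩ e * u e =
      (AP *ᵥ fun i => u ⟨a + 1 + i, by omega⟩) i.succ.castSucc := by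
    intro i
    rw [sum_fin_dumbbell, Finset.sum_eq_zero (s := Finset.univ (α := Fin (b + 1))), add_zero,
      Finset.sum_eq_zero (s := Finset.univ (α := Fin (a + 1))), zero_add]
    · exact Finset.sum_congr rfl fun j _ => by
        rw [B2 _ i.succ.castSucc j]
        simp; omega
    · intro j _
      rw [A1 _ _ (by simp only; omega), zero_mul]
    · intro j _
      rw [A3 _ _ (by simp only; omega), zero_mul]
  have R3 : ∀ i : Fin (b + 1), ∑ e, A ⟨a + k + 1 + i, by omega⟩ e * u e =
      (An *ᵥ fun i => u ⟨a + k + 2 + i, by omega⟩) i +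
        (if i = 0 then (AP *ᵥ fun i => u ⟨a + 1 + i, by omega⟩) (Fin.last _) else 0) := by
    intro i
    rw [sum_fin_dumbbell, Finset.sum_eq_zero (s := Finset.univ (α := Fin (a + 1))), zero_add,
      add_comm]
    · congr 1
      · exact Finset.sum_congr rfl fun j _ => (congrArg (· * _) (hAn i j)).symm
      · split_ifs with h
        · subst h
          exact Finset.sum_congr rfl fun j _ => by rw [B2 _ (Fin.last _) j]; simp; omega
        · refine Finset.sum_eq_zero fun j _ => ?_
          have : (i : ℕ) ≠ 0 := fun h' => h (Fin.ext h')
          rw [A2 _ _ (by simp only; omega) (by simp only; omega), zero_mul]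
    · intro j _
      rw [A1 _ _ (by simp only; omega), zero_mul]
  constructor
  · intro h
    exact ⟨fun i => by rw [← R1]; exact h _, fun i => by rw [← R2]; exact h _,
      fun i => by rw [← R3]; exact h _⟩
  · rintro ⟨h1, h2, h3⟩ ⟨v, hv⟩
    rcases lt_or_ge v (a + 1) with hv1 | hv1
    · exact (R1 ⟨v, hv1⟩).trans (h1 _)
    · rcases lt_or_ge v (a + k + 1) with hv2 | hv2
      · obtain ⟨t, rfl⟩ := Nat.exists_eq_add_of_le hv1
        exact (R2 ⟨t, by omega⟩).trans (h2 _)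
      · obtain ⟨t, rfl⟩ := Nat.exists_eq_add_of_le hv2
        exact (R3 ⟨t, by omega⟩).trans (h3 _)

end DumbbellGraph

/-- Theorem 4.9. Let `D` consist of two unbalanced cycles
`C_m` (`m = a + 1` edges on vertices `v_0, …, v_a`) and `C_n` (`n = b + 1`
edges) connected by a path `P` of length `k = k0 + 1` (edges
`e_{a+1}, …, e_{a+k0+1}`), with the labelling of Notation 4.8 (0-indexed) and
arbitrary edge orientations. Then `I_D` is generated by the primitive binomial
`f_c`, where `c` is `1/d` times the vector whose blocks are
`((-1)^i p r_i)_{i<m}`, `((-1)^{i+a} p q r_{m+i})`, `((-1)^{i+a} q r_{m+k+i})`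
built from the minors `r_i = M_k(A(P)[k+1|∅]) M_{m-1}(A(C_m)[0|i])`,
`r_{m+i} = M_{k-1}(A(P)[0,k|i])`, `r_{m+k+i} = M_k(A(P)[0|∅]) M_{n-1}(A(C_n)[0|i])`,
with `q = det A(C_m)`, `p = det A(C_n)` and `d` the gcd of the absolute values
of all the entries. -/
theorem stmt14 (K : Type*) [Field K] (a b k0 : ℕ) (ha : 2 ≤ a) (hb : 2 ≤ b)
    (w : Fin (a + b + k0 + 2) → ℕ) (hw : ∀ v, 0 < w v)
    (orient : Fin (a + b + k0 + 3) → Bool)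
    (endA endB : Fin (a + b + k0 + 3) → Fin (a + b + k0 + 2))
    (hendA : ∀ j, (endA j : ℕ) =
      if (j : ℕ) < a + 1 then (j : ℕ)
      else if (j : ℕ) = a + 1 then 0 else (j : ℕ) - 1)
    (hendB : ∀ j, (endB j : ℕ) =
      if (j : ℕ) < a + 1 then ((j : ℕ) + 1) % (a + 1)
      else if (j : ℕ) = a + b + k0 + 2 then a + k0 + 1 else (j : ℕ))
    (src tgt : Fin (a + b + k0 + 3) → Fin (a + b + k0 + 2))
    (hsrc : ∀ e, src e = if orient e then endA e else endB e)
    (htgt : ∀ e, tgt e = if orient e then endB e else endA e)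
    (I : Ideal (MvPolynomial (Fin (a + b + k0 + 3)) K))
    (hI : I = RingHom.ker (aeval (R := K)
      (fun e => X (src e) * X (tgt e) ^ w (tgt e)) :
        MvPolynomial (Fin (a + b + k0 + 3)) K →ₐ[K]
          MvPolynomial (Fin (a + b + k0 + 2)) K).toRingHom)
    (A : Matrix (Fin (a + b + k0 + 2)) (Fin (a + b + k0 + 3)) ℤ)
    (hA : ∀ v e, A v e =
      if src e = v then 1 else if tgt e = v then (w v : ℤ) else 0)
    (Am : Matrix (Fin (a + 1)) (Fin (a + 1)) ℤ)
    (hAm : ∀ i j, Am i j =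
      A (Fin.castLE (by omega) i) (Fin.castLE (by omega) j))
    (AP : Matrix (Fin (k0 + 2)) (Fin (k0 + 1)) ℤ)
    (hAP : ∀ i j, AP i j =
      A (if (i : ℕ) = 0 then ⟨0, by omega⟩ else ⟨a + (i : ℕ), by omega⟩)
        ⟨a + 1 + (j : ℕ), by omega⟩)
    (An : Matrix (Fin (b + 1)) (Fin (b + 1)) ℤ)
    (hAn : ∀ i j, An i j =
      A ⟨a + k0 + 1 + (i : ℕ), by omega⟩ ⟨a + k0 + 2 + (j : ℕ), by omega⟩)
    (p q : ℤ) (hp : p = An.det) (hq : q = Am.det)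
    (hCmunbal : q ≠ 0) (hCnunbal : p ≠ 0)
    (MPlast MPfirst : ℤ)
    (hMPlast : MPlast = (AP.submatrix Fin.castSucc id).det)
    (hMPfirst : MPfirst = (AP.submatrix Fin.succ id).det)
    (r1 : Fin (a + 1) → ℤ)
    (hr1 : ∀ i, r1 i =
      MPlast * (Am.submatrix Fin.succ (Fin.succAbove i)).det)
    (r2 : Fin (k0 + 1) → ℤ)
    (hr2 : ∀ i, r2 i =
      (AP.submatrix (fun t : Fin k0 => t.succ.castSucc) (Fin.succAbove i)).det)
    (r3 : Fin (b + 1) → ℤ)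
    (hr3 : ∀ i, r3 i =
      MPfirst * (An.submatrix Fin.succ (Fin.succAbove i)).det)
    (d : ℕ) (hd : d = Nat.gcd
      (Nat.gcd (Finset.univ.gcd fun i => (p * r1 i).natAbs)
        (Finset.univ.gcd fun i => (p * q * r2 i).natAbs))
      (Finset.univ.gcd fun i => (q * r3 i).natAbs))
    (c : Fin (a + b + k0 + 3) → ℤ)
    (hc : ∀ t : Fin (a + b + k0 + 3), c t =
      if h1 : (t : ℕ) < a + 1 then
        ((-1 : ℤ) ^ (t : ℕ) * p * r1 ⟨(t : ℕ), h1⟩) / (d : ℤ)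
      else if h2 : (t : ℕ) < a + k0 + 2 then
        ((-1 : ℤ) ^ ((t : ℕ) + a) * p * q *
          r2 ⟨(t : ℕ) - (a + 1), by omega⟩) / (d : ℤ)
      else
        ((-1 : ℤ) ^ ((t : ℕ) + a) * q *
          r3 ⟨(t : ℕ) - (a + k0 + 2), by omega⟩) / (d : ℤ)) :
    IsPrimitiveIn K I c ∧ I = Ideal.span {binom K c} := by
  have hAE : ∀ v e, (((Finsupp.single (src e) 1 + Finsupp.single (tgt e) (w (tgt e)) :
      Fin (a + b + k0 + 2) →₀ ℕ) v : ℕ) : ℤ) = A v e := by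
    intro v e
    have hne : src e ≠ tgt e := by
      have hlt := e.2
      have h : endA e ≠ endB e := by
        rw [Ne, Fin.ext_iff, hendA, hendB]
        split_ifs with h1
        · rcases Nat.lt_or_ge (e : ℕ) a with h2 | h2
          · rw [Nat.mod_eq_of_lt (by omega)]
            omega
          · have h3 : (e : ℕ) = a := by omega
            rw [h3, Nat.mod_self]
            omega
        all_goals omega
      rw [hsrc, htgt]
      cases orient e
      · simpa using h.symm
      · simpa using h
    rw [hA, Finsupp.add_apply, Finsupp.single_apply, Finsupp.single_apply]
    split_ifs with h1 h2 h2
    · exact absurd (h1.trans h2.symm) hne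
    · simp
    · simp [h2]
    · simp
  have hA0 : ∀ v e, endA e ≠ v → endB e ≠ v → A v e = 0 := by
    intro v e h1 h2
    rw [hA, hsrc, htgt]
    cases orient e <;> simp [h1, h2]
  have hA1 : ∀ v e, endA e = v → A v e ≠ 0 := by
    intro v e h1
    have := (hw v).ne'
    rw [hA, hsrc, htgt]
    cases orient e
    · simp only [Bool.false_eq_true, if_false, h1, if_true]
      split_ifs
      · exact one_ne_zero
      · exact_mod_cast this
    · simp [h1]
  have hiff := forall_sum_eq_zero_iff_dumbbellSystem hendA hendB hA0 hAm hAP hAn (by omega)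
  have hlow : ∀ i j : Fin (k0 + 1), i < j → AP i.castSucc j = 0 := by
    intro i j hij
    have h : (i : ℕ) < j := hij
    have hj := j.2
    rw [hAP]
    apply hA0 <;> rw [Ne, Fin.ext_iff]
    · rw [hendA]; simp only [Fin.val_castSucc]; split_ifs <;> first | omega | (simp only; omega)
    · rw [hendB]; simp only [Fin.val_castSucc]; split_ifs <;> first | omega | (simp only; omega)
  have hdiag : ∀ i : Fin (k0 + 1), AP i.castSucc i ≠ 0 := by
    intro i
    rw [hAP]
    apply hA1
    rw [Fin.ext_iff, hendA]
    simp only [Fin.val_castSucc]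
    split_ifs <;> first | rfl | omega | (simp only; omega)
  have hinj : ∀ u : Fin (a + b + k0 + 3) → ℤ, (∀ v, ∑ e, A v e * u e = 0) →
      u ⟨a + 1, by omega⟩ = 0 → u = 0 := by
    intro u hu h0
    obtain ⟨h1, h2, h3⟩ := ((hiff u).1 hu).eq_zero (hq ▸ hCmunbal) (hp ▸ hCnunbal) hlow hdiag h0
    funext ⟨t, ht⟩
    rcases lt_or_ge t (a + 1) with ht1 | ht1
    · exact congrFun h1 ⟨t, ht1⟩
    · rcases lt_or_ge t (a + k0 + 2) with ht2 | ht2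
      · obtain ⟨s, rfl⟩ := Nat.exists_eq_add_of_le ht1
        exact congrFun h2 ⟨s, by omega⟩
      · obtain ⟨s, rfl⟩ := Nat.exists_eq_add_of_le ht2
        exact congrFun h3 ⟨s, by omega⟩
  obtain ⟨C, hC⟩ : ∃ C : Fin (a + b + k0 + 3) → ℤ, ∀ t, C t =
      if h1 : (t : ℕ) < a + 1 then (-1 : ℤ) ^ (t : ℕ) * p * r1 ⟨(t : ℕ), h1⟩
      else if h2 : (t : ℕ) < a + k0 + 2 then
        (-1 : ℤ) ^ ((t : ℕ) + a) * p * q * r2 ⟨(t : ℕ) - (a + 1), by omega⟩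
      else (-1 : ℤ) ^ ((t : ℕ) + a) * q * r3 ⟨(t : ℕ) - (a + k0 + 2), by omega⟩ :=
    ⟨_, fun _ => rfl⟩
  have hC1 : ∀ i : Fin (a + 1), C ⟨i, by omega⟩ = (-1) ^ (i : ℕ) * p * r1 i := by
    intro i
    rw [hC, dif_pos i.2]
  have hC2 : ∀ i : Fin (k0 + 1), C ⟨a + 1 + i, by omega⟩ =
      (-1) ^ ((a + 1 + i : ℕ) + a) * p * q * r2 i := by
    intro i
    rw [hC, dif_neg (by simp only; omega), dif_pos (by simp only; omega)]
    congr 3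
    simp
  have hC3 : ∀ i : Fin (b + 1), C ⟨a + k0 + 2 + i, by omega⟩ =
      (-1) ^ ((a + k0 + 2 + i : ℕ) + a) * q * r3 i := by
    intro i
    rw [hC, dif_neg (by simp only; omega), dif_neg (by simp only; omega)]
    congr 3
    simp
  have hsgn : ((-1 : ℤ) ^ a) * (-1) ^ a = 1 := by rw [← mul_pow]; simp
  have hCsys : DumbbellSystem Am AP An (fun i => C ⟨i, by omega⟩)
      (fun i => C ⟨a + 1 + i, by omega⟩) (fun i => C ⟨a + k0 + 2 + i, by omega⟩) := by
    convert dumbbellSystem_minors (Am := Am) (AP := AP) (An := An) using 2 with i i i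
    · rw [hC1, hr1, hMPlast, hp]; ring
    · rw [hC2, hr2, hp, hq]
      simp only [pow_add, pow_one]
      linear_combination (-(-1) ^ (i : ℕ) * An.det * Am.det *
        (AP.submatrix (fun t : Fin k0 => t.succ.castSucc) i.succAbove).det) * hsgn
    · rw [hC3, hr3, hMPfirst, hq]
      simp only [pow_add]
      linear_combination ((-1) ^ (i : ℕ) * (-1) ^ k0 * Am.det *
        (AP.submatrix Fin.succ id).det *
        (An.submatrix Fin.succ i.succAbove).det) * hsgn
  have hCker : ∀ v, ∑ e, A v e * C e = 0 := (hiff C).2 hCsys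
  have hCne : C ≠ 0 := by
    intro h
    have h0 := mulVec_alternating_minor Am
      (An.det * (AP.submatrix Fin.castSucc id).det) 0
    have hx : (fun j : Fin (a + 1) => An.det * (AP.submatrix Fin.castSucc id).det *
        ((-1) ^ (j : ℕ) * (Am.submatrix Fin.succ j.succAbove).det)) = 0 := by
      funext j
      have := hC1 j
      rw [hr1, hMPlast, hp, h, Pi.zero_apply] at this
      rw [Pi.zero_apply]
      linarith
    rw [hx, Matrix.mulVec_zero, if_pos rfl] at h0
    exact mul_ne_zero (mul_ne_zero (hp ▸ hCnunbal) (det_path_ne_zero hlow hdiag))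
      (hq ▸ hCmunbal) h0.symm
  have hs : ∀ n : ℕ, ((-1 : ℤ) ^ n).natAbs = 1 := fun n => by simp [Int.natAbs_pow]
  have hN1 : ∀ i, (p * r1 i).natAbs = (C ⟨i, by omega⟩).natAbs := fun i => by
    rw [hC1]; simp only [Int.natAbs_mul, hs, one_mul]
  have hN2 : ∀ i, (p * q * r2 i).natAbs = (C ⟨a + 1 + i, by omega⟩).natAbs := fun i => by
    rw [hC2]; simp only [Int.natAbs_mul, hs, one_mul]
  have hN3 : ∀ i, (q * r3 i).natAbs = (C ⟨a + k0 + 2 + i, by omega⟩).natAbs := fun i => by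
    rw [hC3]; simp only [Int.natAbs_mul, hs, one_mul]
  simp only [hN1, hN2, hN3] at hd
  have hdC : ∀ t, (d : ℤ) ∣ C t := by
    rintro ⟨t, ht⟩
    rw [← Int.dvd_natAbs, Int.natCast_dvd_natCast, hd]
    rcases lt_or_ge t (a + 1) with ht1 | ht1
    · exact ((Nat.gcd_dvd_left _ _).trans (Nat.gcd_dvd_left _ _)).trans
        (Finset.gcd_dvd (Finset.mem_univ (⟨t, ht1⟩ : Fin (a + 1))))
    · rcases lt_or_ge t (a + k0 + 2) with ht2 | ht2
      · obtain ⟨s, rfl⟩ := Nat.exists_eq_add_of_le ht1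
        exact ((Nat.gcd_dvd_left _ _).trans (Nat.gcd_dvd_right _ _)).trans
          (Finset.gcd_dvd (Finset.mem_univ (⟨s, by omega⟩ : Fin (k0 + 1))))
      · obtain ⟨s, rfl⟩ := Nat.exists_eq_add_of_le ht2
        exact (Nat.gcd_dvd_right _ _).trans
          (Finset.gcd_dvd (Finset.mem_univ (⟨s, by omega⟩ : Fin (b + 1))))
  have hdmul : ∀ x y : ℕ, (∀ t, x ∣ y * (C t).natAbs) → x ∣ y * d := by
    intro x y h
    rw [hd, ← Nat.gcd_mul_left, ← Nat.gcd_mul_left]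
    exact Nat.dvd_gcd (Nat.dvd_gcd (dvd_mul_finset_gcd _ _ _ _ fun i _ => h _)
      (dvd_mul_finset_gcd _ _ _ _ fun i _ => h _)) (dvd_mul_finset_gcd _ _ _ _ fun i _ => h _)
  have hCc : ∀ t, C t = d * c t := by
    intro t
    have : c t = C t / d := by
      rw [hc, hC]
      split_ifs <;> rfl
    rw [this, Int.mul_ediv_cancel' (hdC t)]
  have hd0 : (d : ℤ) ≠ 0 := by
    intro h
    exact hCne (funext fun t => by rw [hCc, h, zero_mul, Pi.zero_apply])
  have hcker : ∀ v, ∑ e, A v e * c e = 0 := by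
    intro v
    have := hCker v
    simp only [hCc, mul_left_comm _ (d : ℤ), ← Finset.mul_sum] at this
    exact (mul_eq_zero.1 this).resolve_left hd0
  have hc0 : c ≠ 0 := by
    rintro rfl
    exact hCne (funext fun t => by simp [hCc])
  refine toric_of_kernel_rank_one
    (fun e => Finsupp.single (src e) 1 + Finsupp.single (tgt e) (w (tgt e))) c hc0
    (by simpa only [hAE] using hcker) ?_ I ?_
  · intro u hu
    simp only [hAE] at hu
    set e₀ : Fin (a + b + k0 + 3) := ⟨a + 1, by omega⟩ with he₀
    have hce : c e₀ ≠ 0 := fun h => hc0 (hinj c hcker h)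
    have hprop : ∀ t, c e₀ * u t = u e₀ * c t := by
      intro t
      have := congrFun (hinj (fun t => c e₀ * u t - u e₀ * c t) (fun v => by
        simp only [mul_sub, Finset.sum_sub_distrib, mul_left_comm (A v _), ← Finset.mul_sum, hu,
          hcker, mul_zero, sub_zero]) (sub_eq_zero.2 (mul_comm _ _))) t
      exact sub_eq_zero.1 this
    have hdvd : c e₀ ∣ u e₀ := by
      have h := hdmul (d * (c e₀).natAbs) (u e₀).natAbs fun t => by
        rw [hCc, Int.natAbs_mul, Int.natAbs_natCast, mul_left_comm, ← Int.natAbs_mul, ← hprop t]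
        exact mul_dvd_mul_left _ (by rw [Int.natAbs_mul]; exact dvd_mul_right _ _)
      rw [mul_comm] at h
      exact Int.natAbs_dvd_natAbs.1 (Nat.dvd_of_mul_dvd_mul_right
        (Nat.pos_of_ne_zero (by exact_mod_cast hd0)) h)
    obtain ⟨k, hk⟩ := hdvd
    refine ⟨k, fun t => mul_left_cancel₀ hce ?_⟩
    rw [hprop, hk]
    ring
  · rw [hI]
    have : ∀ e, (X (src e) * X (tgt e) ^ w (tgt e) : MvPolynomial (Fin (a + b + k0 + 2)) K) =
        monomial (Finsupp.single (src e) 1 + Finsupp.single (tgt e) (w (tgt e))) 1 := by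
      intro e
      rw [X_pow_eq_monomial, X, monomial_mul, mul_one]
    simp only [this]
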